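/- Let 0 ≤ t < S < T. Let B̃ : [0,T] → ℝ^{d×d}, ã : [0,T] → ℝ^{d×d} and β̃ : [0,T] → ℝ^d be continuous, with ã(τ) symmetric positive semidefinite for every τ, let Φ : [0,T] → ℝ^{d×d} satisfy Φ′(r) = B̃(r)Φ(r), Φ(0) = I with Φ(r) invertible for every r, and write Φ(u,s) := Φ(u)Φ(s)⁻¹. For s < u set Γ(s,u) := ∫_s^u Φ(u,τ) ã(τ) Φ(u,τ)ᵀ dτ and assume Γ(t,S) and Γ(S,T) are positive definite, and define the Gaussian transition density p̃(s,x;u,ξ) := φ(ξ − Φ(u,s)x − ∫_s^u Φ(u,τ)β̃(τ) dτ; Γ(s,u)). Let L_S ∈ ℝ^{m_S×d}, L_T ∈ ℝ^{m_T×d}, let Σ_S ∈ ℝ^{m_S×m_S} and Σ_T ∈ ℝ^{m_T×m_T} be symmetric positive definite, and let v_S ∈ ℝ^{m_S}, v_T ∈ ℝ^{m_T}. Define L̃(t) ∈ ℝ^{(m_S+m_T)×d} as the vertical stack of L_S Φ(S,t) and L_T Φ(T,t), define μ(t) ∈ ℝ^{m_S+m_T} as the vertical stack of ∫_t^S L_S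 Φ(S,τ)β̃(τ) dτ and ∫_t^T L_T Φ(T,τ)β̃(τ) dτ, and define M̃†(t) ∈ ℝ^{(m_S+m_T)×(m_S+m_T)} as the block matrix with (1,1) block ∫_t^S L_S Φ(S,τ) ã(τ) Φ(S,τ)ᵀ L_Sᵀ dτ + Σ_S, (1,2) block ∫_t^S L_S Φ(S,τ) ã(τ) Φ(T,τ)ᵀ L_Tᵀ dτ, (2,1) block the transpose of the (1,2) block, and (2,2) block ∫_t^T L_T Φ(T,τ) ã(τ) Φ(T,τ)ᵀ L_Tᵀ dτ + Σ_T. Then M̃†(t) is symmetric positive definite and for every x ∈ ℝ^d, ∫_{ℝ^d} ∫_{ℝ^d} p̃(t,x;S,ξ) p̃(S,ξ;T,η) φ(v_S − L_S ξ; Σ_S) φ(v_T − L_T η; Σ_T) dη dξ = φ(x_obs − μ(t) − L̃(t)x; M̃†(t)), where x_obs ∈ ℝ^{m_S+m_T} is the vertical stack of v_S and v_T. -/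

import Mathlib

open Matrix MeasureTheory intervalIntegral

/-- Density of the `N(0,V)` distribution evaluated at `y`. -/
noncomputable def gaussianDensity {ι : Type*} [Fintype ι] [DecidableEq ι]
    (y : ι → ℝ) (V : Matrix ι ι ℝ) : ℝ :=
  (2 * Real.pi) ^ (-(Fintype.card ι : ℝ) / 2) * V.det ^ (-(1 : ℝ) / 2) *
    Real.exp (-(1 / 2) * (y ⬝ᵥ V⁻¹ *ᵥ y))

/-- The transition matrix `Φ(u,s) = Φ(u) Φ(s)⁻¹` of the linear system. -/
noncomputable def transMat {d : ℕ} (Φ : ℝ → Matrix (Fin d) (Fin d) ℝ) (u s : ℝ) :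
    Matrix (Fin d) (Fin d) ℝ :=
  Φ u * (Φ s)⁻¹

/-- The covariance `Γ(s,u) = ∫_s^u Φ(u,τ) ã(τ) Φ(u,τ)ᵀ dτ` of the linear system. -/
noncomputable def transCov {d : ℕ} (Φ atil : ℝ → Matrix (Fin d) (Fin d) ℝ)
    (s u : ℝ) : Matrix (Fin d) (Fin d) ℝ :=
  Matrix.of fun i j =>
    ∫ τ in s..u, (transMat Φ u τ * atil τ * (transMat Φ u τ)ᵀ) i j

/-- The Gaussian transition density
`p̃(s,x;u,ξ) = φ(ξ − Φ(u,s)x − ∫_s^u Φ(u,τ)β̃(τ)dτ; Γ(s,u))` of the linear system. -/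
noncomputable def transDensity {d : ℕ} (Φ atil : ℝ → Matrix (Fin d) (Fin d) ℝ)
    (βtil : ℝ → Fin d → ℝ) (s : ℝ) (x : Fin d → ℝ) (u : ℝ) (ξ : Fin d → ℝ) : ℝ :=
  gaussianDensity
    (ξ - transMat Φ u s *ᵥ x - fun i => ∫ τ in s..u, (transMat Φ u τ *ᵥ βtil τ) i)
    (transCov Φ atil s u)

namespace GaussianConvolution

variable {ι κ : Type*} [Fintype ι] [Fintype κ]

lemma integral_exp_neg_half_dotProduct_self :
    ∫ z : ι → ℝ, Real.exp (-(1 / 2) * (z ⬝ᵥ z)) =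
      (2 * Real.pi) ^ ((Fintype.card ι : ℝ) / 2) := by
  have h (z : ι → ℝ) :
      Real.exp (-(1 / 2) * (z ⬝ᵥ z)) = ∏ i, Real.exp (-(1 / 2) * z i ^ 2) := by
    rw [← Real.exp_sum, dotProduct, Finset.mul_sum]
    simp only [sq]
  simp_rw [h]
  rw [integral_fintype_prod_volume_eq_pow (fun x : ℝ => Real.exp (-(1 / 2) * x ^ 2)),
    integral_gaussian, Real.sqrt_eq_rpow, ← Real.rpow_natCast, ← Real.rpow_mul (by positivity)]
  congr 1 <;> ring

lemma posDef_add_mul_mul_transpose {A : Matrix ι ι ℝ} {B : Matrix κ κ ℝ}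
    (hA : A.PosDef) (hB : B.PosDef) (L : Matrix κ ι ℝ) : (B + L * A * Lᵀ).PosDef := by
  have h := hA.posSemidef.mul_mul_conjTranspose_same L
  rw [conjTranspose_eq_transpose_of_trivial] at h
  exact hB.add_posSemidef h

lemma dotProduct_mulVec_comm_of_posDef {A : Matrix ι ι ℝ} (hA : A.PosDef) (x y : ι → ℝ) :
    x ⬝ᵥ A *ᵥ y = y ⬝ᵥ A *ᵥ x := by
  have h : Aᵀ = A := by simpa [conjTranspose_eq_transpose_of_trivial] using hA.isHermitian.eq
  rw [dotProduct_comm, ← vecMul_transpose, h, ← dotProduct_mulVec]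

variable [DecidableEq ι] [DecidableEq κ]

open scoped MatrixOrder Matrix.Norms.L2Operator in
/-- A real positive definite matrix factors as `Mᵀ * M` with `M` invertible. -/
lemma exists_isUnit_eq_transpose_mul_self {P : Matrix ι ι ℝ} (hP : P.PosDef) :
    ∃ M : Matrix ι ι ℝ, IsUnit M ∧ P = Mᵀ * M := by
  obtain ⟨M, hM, h⟩ := CStarAlgebra.isStrictlyPositive_iff_eq_star_mul_self.mp
    hP.isStrictlyPositive
  exact ⟨M, hM, by rw [h, star_eq_conjTranspose, conjTranspose_eq_transpose_of_trivial]⟩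

lemma integral_comp_mulVec {M : Matrix ι ι ℝ} (hM : M.det ≠ 0) (f : (ι → ℝ) → ℝ) :
    ∫ y, f (M *ᵥ y) = |M.det|⁻¹ * ∫ y, f y := by
  have he : MeasurableEmbedding (toLin' M) :=
    (LinearMap.continuous_on_pi _).measurableEmbedding
      (mulVec_injective_iff_isUnit.mpr ((isUnit_iff_isUnit_det M).mpr hM.isUnit))
  have := he.integral_map (μ := volume) f
  rw [Real.map_matrix_volume_pi_eq_smul_volume_pi hM, MeasureTheory.integral_smul_measure,
    ENNReal.toReal_ofReal (abs_nonneg _), abs_inv, smul_eq_mul] at this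
  simpa using this.symm

/-- The density of a nondegenerate centred Gaussian has total mass one. -/
lemma integral_gaussianDensity {V : Matrix ι ι ℝ} (hV : V.PosDef) :
    ∫ y, gaussianDensity y V = 1 := by
  obtain ⟨M, hM, hVM⟩ := exists_isUnit_eq_transpose_mul_self hV.inv
  have hdet : M.det ≠ 0 := ((isUnit_iff_isUnit_det M).mp hM).ne_zero
  have hq (y : ι → ℝ) : y ⬝ᵥ V⁻¹ *ᵥ y = (M *ᵥ y) ⬝ᵥ (M *ᵥ y) := by
    rw [hVM, ← mulVec_mulVec, dotProduct_mulVec, vecMul_transpose]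
  have hVdet : V.det = (|M.det| ^ (2 : ℝ))⁻¹ := by
    have := congrArg det hVM
    rw [det_nonsing_inv, Ring.inverse_eq_inv', det_mul, det_transpose] at this
    rw [← inv_inv V.det, this, Real.rpow_two, sq_abs, sq]
  simp_rw [gaussianDensity, hq]
  rw [MeasureTheory.integral_const_mul,
    integral_comp_mulVec hdet (fun z => Real.exp (-(1 / 2) * (z ⬝ᵥ z))),
    integral_exp_neg_half_dotProduct_self, hVdet, Real.inv_rpow (by positivity),
    ← Real.rpow_mul (abs_nonneg _), neg_div, Real.rpow_neg (by positivity)]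
  have : (2 * Real.pi) ^ ((Fintype.card ι : ℝ) / 2) ≠ 0 := by positivity
  have : |M.det| ≠ 0 := abs_ne_zero.mpr hdet
  rw [show (2 : ℝ) * (-1 / 2) = -1 by norm_num, Real.rpow_neg_one]
  field_simp

/-- Bayes' rule for Gaussian densities: prior times likelihood is evidence times posterior. -/
lemma gaussianDensity_mul_gaussianDensity {A : Matrix ι ι ℝ} {B : Matrix κ κ ℝ}
    (hA : A.PosDef) (hB : B.PosDef) (L : Matrix κ ι ℝ) (z : ι → ℝ) (y : κ → ℝ) :
    gaussianDensity z A * gaussianDensity (y - L *ᵥ z) B =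
      gaussianDensity y (B + L * A * Lᵀ) *
        gaussianDensity (z - (A⁻¹ + Lᵀ * B⁻¹ * L)⁻¹ *ᵥ Lᵀ *ᵥ B⁻¹ *ᵥ y)
          (A⁻¹ + Lᵀ * B⁻¹ * L)⁻¹ := by
  set P := A⁻¹ + Lᵀ * B⁻¹ * L with hPdef
  have hP : P.PosDef := by
    simpa using posDef_add_mul_mul_transpose hB.inv hA.inv Lᵀ
  have hC := posDef_add_mul_mul_transpose hA hB L
  have hPu : IsUnit P.det := (isUnit_iff_isUnit_det P).mp hP.isUnit
  have hAu : IsUnit A.det := (isUnit_iff_isUnit_det A).mp hA.isUnit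
  have hBu : IsUnit B.det := (isUnit_iff_isUnit_det B).mp hB.isUnit
  set c := P⁻¹ *ᵥ Lᵀ *ᵥ B⁻¹ *ᵥ y with hc
  have hPc : P *ᵥ c = Lᵀ *ᵥ B⁻¹ *ᵥ y := by
    rw [hc, mulVec_mulVec, mul_nonsing_inv _ hPu, one_mulVec]
  have hCy : (B + L * A * Lᵀ)⁻¹ *ᵥ y = B⁻¹ *ᵥ y - B⁻¹ *ᵥ L *ᵥ c := by
    rw [add_mul_mul_inv_eq_sub _ _ _ _ hB.isUnit hA.isUnit hP.isUnit, ← hPdef, sub_mulVec, hc]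
    simp only [mulVec_mulVec, Matrix.mul_assoc]
  have hdet : A.det * B.det = (B + L * A * Lᵀ).det * (P⁻¹).det := by
    have h1 : (B + L * A * Lᵀ).det = B.det * (A.det * P.det) := by
      rw [Matrix.mul_assoc, det_add_mul _ _ hBu, ← det_mul, hPdef, Matrix.mul_add,
        mul_nonsing_inv _ hAu]
      simp only [Matrix.mul_assoc]
    rw [h1, det_nonsing_inv, Ring.inverse_eq_inv']
    field_simp [hPu.ne_zero]
  have hquad : z ⬝ᵥ A⁻¹ *ᵥ z + (y - L *ᵥ z) ⬝ᵥ B⁻¹ *ᵥ (y - L *ᵥ z) =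
      y ⬝ᵥ (B + L * A * Lᵀ)⁻¹ *ᵥ y + (z - c) ⬝ᵥ (P⁻¹)⁻¹ *ᵥ (z - c) := by
    have hLt (u : ι → ℝ) (w : κ → ℝ) : u ⬝ᵥ Lᵀ *ᵥ w = w ⬝ᵥ L *ᵥ u := by
      rw [dotProduct_comm, mulVec_transpose, dotProduct_mulVec]
    have hBs := dotProduct_mulVec_comm_of_posDef hB.inv
    have hPs := dotProduct_mulVec_comm_of_posDef hP c z
    have hPz : P *ᵥ z = A⁻¹ *ᵥ z + Lᵀ *ᵥ B⁻¹ *ᵥ L *ᵥ z := by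
      rw [hPdef, add_mulVec]
      simp only [mulVec_mulVec, Matrix.mul_assoc]
    have hLB (u v : ι → ℝ) : u ⬝ᵥ Lᵀ *ᵥ B⁻¹ *ᵥ L *ᵥ v = (L *ᵥ u) ⬝ᵥ B⁻¹ *ᵥ L *ᵥ v := by
      rw [hLt, dotProduct_comm]
    have hLy (u : ι → ℝ) : u ⬝ᵥ Lᵀ *ᵥ B⁻¹ *ᵥ y = y ⬝ᵥ B⁻¹ *ᵥ L *ᵥ u := by
      rw [hLt, dotProduct_comm, hBs]
    rw [nonsing_inv_nonsing_inv _ hPu, hCy]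
    simp only [mulVec_sub, sub_dotProduct, dotProduct_sub]
    rw [hPs, hPc, hPz, dotProduct_add, hLB, hLy, hLy, hBs (L *ᵥ z) y]
    ring
  have hexp : Real.exp (-(1 / 2) * (z ⬝ᵥ A⁻¹ *ᵥ z)) *
        Real.exp (-(1 / 2) * ((y - L *ᵥ z) ⬝ᵥ B⁻¹ *ᵥ (y - L *ᵥ z))) =
      Real.exp (-(1 / 2) * (y ⬝ᵥ (B + L * A * Lᵀ)⁻¹ *ᵥ y)) *
        Real.exp (-(1 / 2) * ((z - c) ⬝ᵥ (P⁻¹)⁻¹ *ᵥ (z - c))) := by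
    rw [← Real.exp_add, ← Real.exp_add, ← mul_add, ← mul_add, hquad]
  have hdet' : A.det ^ (-(1 : ℝ) / 2) * B.det ^ (-(1 : ℝ) / 2) =
      (B + L * A * Lᵀ).det ^ (-(1 : ℝ) / 2) * (P⁻¹).det ^ (-(1 : ℝ) / 2) := by
    rw [← Real.mul_rpow hA.det_pos.le hB.det_pos.le,
      ← Real.mul_rpow hC.det_pos.le hP.inv.det_pos.le, hdet]
  unfold gaussianDensity
  linear_combination
    ((2 * Real.pi) ^ (-(Fintype.card ι : ℝ) / 2) * (2 * Real.pi) ^ (-(Fintype.card κ : ℝ) / 2)) *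
    (A.det ^ (-(1 : ℝ) / 2) * B.det ^ (-(1 : ℝ) / 2) * hexp +
      Real.exp (-(1 / 2) * (y ⬝ᵥ (B + L * A * Lᵀ)⁻¹ *ᵥ y)) *
        Real.exp (-(1 / 2) * ((z - c) ⬝ᵥ (P⁻¹)⁻¹ *ᵥ (z - c))) * hdet')

/-- The law of a linear Gaussian observation of a Gaussian vector. -/
lemma integral_gaussianDensity_mul_gaussianDensity {A : Matrix ι ι ℝ} {B : Matrix κ κ ℝ}
    (hA : A.PosDef) (hB : B.PosDef) (L : Matrix κ ι ℝ) (m : ι → ℝ) (w : κ → ℝ) :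
    ∫ ξ, gaussianDensity (ξ - m) A * gaussianDensity (w - L *ᵥ ξ) B =
      gaussianDensity (w - L *ᵥ m) (B + L * A * Lᵀ) := by
  have hP : ((A⁻¹ + Lᵀ * B⁻¹ * L)⁻¹).PosDef := by
    simpa using (posDef_add_mul_mul_transpose hB.inv hA.inv Lᵀ).inv
  have h (ξ : ι → ℝ) : w - L *ᵥ ξ = w - L *ᵥ m - L *ᵥ (ξ - m) := by
    rw [mulVec_sub]; abel
  have h' (ξ : ι → ℝ) := gaussianDensity_mul_gaussianDensity hA hB L (ξ - m) (w - L *ᵥ m)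
  simp_rw [← h, sub_sub _ m] at h'
  simp_rw [h']
  rw [MeasureTheory.integral_const_mul,
    integral_sub_right_eq_self (fun z => gaussianDensity z (A⁻¹ + Lᵀ * B⁻¹ * L)⁻¹),
    integral_gaussianDensity hP, mul_one]

lemma posDef_fromBlocks_zero {A : Matrix ι ι ℝ} {B : Matrix κ κ ℝ}
    (hA : A.PosDef) (hB : B.PosDef) : (fromBlocks A 0 0 B).PosDef := by
  have := hA.isUnit.invertible
  have hps : (fromBlocks A 0 (0 : Matrix ι κ ℝ)ᴴ B).PosSemidef :=
    (PosDef.fromBlocks₁₁ 0 B hA).mpr (by simpa using hB.posSemidef)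
  rw [conjTranspose_zero] at hps
  exact hps.posDef_iff_isUnit.mpr (isUnit_fromBlocks_zero₂₁.mpr ⟨hA.isUnit, hB.isUnit⟩)

/-- Independent Gaussians have the product density. -/
lemma gaussianDensity_sumElim {A : Matrix ι ι ℝ} {B : Matrix κ κ ℝ}
    (hA : A.PosDef) (hB : B.PosDef) (y : ι → ℝ) (z : κ → ℝ) :
    gaussianDensity (Sum.elim y z) (fromBlocks A 0 0 B) =
      gaussianDensity y A * gaussianDensity z B := by
  have hinv : (fromBlocks A 0 0 B)⁻¹ = fromBlocks A⁻¹ 0 0 B⁻¹ := by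
    rw [inv_fromBlocks_zero₂₁_of_isUnit_iff _ _ _ (iff_of_true hA.isUnit hB.isUnit)]
    simp
  unfold gaussianDensity
  rw [hinv, det_fromBlocks_zero₂₁, Real.mul_rpow hA.det_pos.le hB.det_pos.le,
    fromBlocks_mulVec, Fintype.card_sum, Nat.cast_add, neg_add, add_div,
    Real.rpow_add (by positivity)]
  simp only [Sum.elim_comp_inl, Sum.elim_comp_inr, zero_mulVec, add_zero, zero_add,
    sumElim_dotProduct_sumElim, mul_add, Real.exp_add]
  ring

end GaussianConvolution

section IntervalIntegralMatrix

variable {ι κ ι' κ' : Type*} [Fintype κ] [Fintype ι']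

lemma mul_of_intervalIntegral_mul {a b : ℝ} {F : ℝ → Matrix κ ι' ℝ}
    (hF : ∀ i j, IntervalIntegrable (fun τ => F τ i j) volume a b)
    (X : Matrix ι κ ℝ) (Y : Matrix ι' κ' ℝ) :
    X * (Matrix.of fun i j => ∫ τ in a..b, F τ i j) * Y =
      Matrix.of fun i j => ∫ τ in a..b, (X * F τ * Y) i j := by
  ext i j
  simp only [mul_apply, of_apply, Finset.sum_mul]
  rw [intervalIntegral.integral_finsetSum fun k _ => by
    simpa only [Finset.sum_fn] using IntervalIntegrable.sum Finset.univ fun l _ =>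
      ((hF l k).const_mul (X i l)).mul_const (Y k j)]
  refine Finset.sum_congr rfl fun k _ => ?_
  rw [intervalIntegral.integral_finsetSum fun l _ => ((hF l k).const_mul _).mul_const _]
  simp

lemma mulVec_intervalIntegral {a b : ℝ} {f : ℝ → κ → ℝ}
    (hf : ∀ i, IntervalIntegrable (fun τ => f τ i) volume a b) (X : Matrix ι κ ℝ) :
    X *ᵥ (fun i => ∫ τ in a..b, f τ i) = fun i => ∫ τ in a..b, (X *ᵥ f τ) i := by
  ext i
  simp only [mulVec, dotProduct]
  rw [intervalIntegral.integral_finsetSum fun k _ => (hf k).const_mul _]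
  simp

end IntervalIntegralMatrix

lemma continuousOn_matrix_inv {n : Type*} [Fintype n] [DecidableEq n] {s : Set ℝ}
    {F : ℝ → Matrix n n ℝ} (hF : ContinuousOn F s) (hu : ∀ r ∈ s, IsUnit (F r)) :
    ContinuousOn (fun r => (F r)⁻¹) s := by
  simp_rw [inv_def, Ring.inverse_eq_inv']
  refine ContinuousOn.smul (ContinuousOn.inv₀ ?_ fun r hr =>
    ((isUnit_iff_isUnit_det _).mp (hu r hr)).ne_zero) ?_
  · exact continuous_id.matrix_det.comp_continuousOn hF
  · exact continuous_id.matrix_adjugate.comp_continuousOn hF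

lemma transMat_mul_transMat {d : ℕ} (Φ : ℝ → Matrix (Fin d) (Fin d) ℝ) (u s r : ℝ)
    (hs : IsUnit (Φ s)) : transMat Φ u s * transMat Φ s r = transMat Φ u r := by
  rw [transMat, transMat, transMat, Matrix.mul_assoc,
    nonsing_inv_mul_cancel_left _ _ ((isUnit_iff_isUnit_det _).mp hs)]

lemma continuousOn_matrix_mul {l m n : Type*} [Fintype m] {s : Set ℝ}
    {F : ℝ → Matrix l m ℝ} {G : ℝ → Matrix m n ℝ} (hF : ContinuousOn F s)
    (hG : ContinuousOn G s) : ContinuousOn (fun r => F r * G r) s := by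
  rw [continuousOn_iff_continuous_domRestrict] at *
  exact hF.matrix_mul hG

lemma continuousOn_mulVec {m n : Type*} [Fintype n] {s : Set ℝ}
    {F : ℝ → Matrix m n ℝ} {g : ℝ → n → ℝ} (hF : ContinuousOn F s)
    (hg : ContinuousOn g s) : ContinuousOn (fun r => F r *ᵥ g r) s := by
  rw [continuousOn_iff_continuous_domRestrict] at *
  exact hF.matrix_mulVec hg

lemma continuousOn_matrix_transpose {m n : Type*} {s : Set ℝ} {F : ℝ → Matrix m n ℝ}
    (hF : ContinuousOn F s) : ContinuousOn (fun r => (F r)ᵀ) s := by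
  rw [continuousOn_iff_continuous_domRestrict] at *
  exact hF.matrix_transpose

lemma continuousOn_matrix_iff {m n : Type*} {s : Set ℝ} {F : ℝ → Matrix m n ℝ} :
    ContinuousOn F s ↔ ∀ i j, ContinuousOn (fun r => F r i j) s :=
  continuousOn_pi.trans (forall_congr' fun _ => continuousOn_pi)

theorem rho_tilde_closed_form {d mS mT : ℕ} (t S T : ℝ)
    (ht : 0 ≤ t) (htS : t < S) (hST : S < T)
    (Btil atil : ℝ → Matrix (Fin d) (Fin d) ℝ) (βtil : ℝ → Fin d → ℝ)
    (hB : ContinuousOn Btil (Set.Icc 0 T)) (ha : ContinuousOn atil (Set.Icc 0 T))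
    (hβ : ContinuousOn βtil (Set.Icc 0 T))
    (hapsd : ∀ τ ∈ Set.Icc (0 : ℝ) T, (atil τ).PosSemidef)
    (Φ : ℝ → Matrix (Fin d) (Fin d) ℝ)
    (hΦ : ∀ r ∈ Set.Icc (0 : ℝ) T, ∀ i j,
      HasDerivAt (fun u => Φ u i j) ((Btil r * Φ r) i j) r)
    (hΦ0 : Φ 0 = 1)
    (hΦinv : ∀ r ∈ Set.Icc (0 : ℝ) T, IsUnit (Φ r))
    (hΓtS : (transCov Φ atil t S).PosDef)
    (hΓST : (transCov Φ atil S T).PosDef)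
    (LS : Matrix (Fin mS) (Fin d) ℝ) (LT : Matrix (Fin mT) (Fin d) ℝ)
    (SigS : Matrix (Fin mS) (Fin mS) ℝ) (SigT : Matrix (Fin mT) (Fin mT) ℝ)
    (hSigS : SigS.PosDef) (hSigT : SigT.PosDef)
    (vS : Fin mS → ℝ) (vT : Fin mT → ℝ)
    -- the quantities appearing in Theorem 2.1:
    (Ltil : Matrix (Fin mS ⊕ Fin mT) (Fin d) ℝ)
    (hLtil : Ltil = Matrix.fromRows (LS * transMat Φ S t) (LT * transMat Φ T t))
    (μ : Fin mS ⊕ Fin mT → ℝ)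
    (hμ : μ = Sum.elim
      (fun i => ∫ τ in t..S, ((LS * transMat Φ S τ) *ᵥ βtil τ) i)
      (fun i => ∫ τ in t..T, ((LT * transMat Φ T τ) *ᵥ βtil τ) i))
    (Mdag : Matrix (Fin mS ⊕ Fin mT) (Fin mS ⊕ Fin mT) ℝ)
    (hMdag : Mdag = Matrix.fromBlocks
      ((Matrix.of fun i j =>
        ∫ τ in t..S, (LS * transMat Φ S τ * atil τ * (transMat Φ S τ)ᵀ * LSᵀ) i j) + SigS)
      (Matrix.of fun i j =>
        ∫ τ in t..S, (LS * transMat Φ S τ * atil τ * (transMat Φ T τ)ᵀ * LTᵀ) i j)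
      (Matrix.of fun i j =>
        ∫ τ in t..S, (LS * transMat Φ S τ * atil τ * (transMat Φ T τ)ᵀ * LTᵀ) i j)ᵀ
      ((Matrix.of fun i j =>
        ∫ τ in t..T, (LT * transMat Φ T τ * atil τ * (transMat Φ T τ)ᵀ * LTᵀ) i j) + SigT)) :
    Mdag.PosDef ∧
      ∀ x : Fin d → ℝ,
        (∫ ξ : Fin d → ℝ, ∫ η : Fin d → ℝ,
            transDensity Φ atil βtil t x S ξ * transDensity Φ atil βtil S ξ T η *
              gaussianDensity (vS - LS *ᵥ ξ) SigS *
              gaussianDensity (vT - LT *ᵥ η) SigT) =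
          gaussianDensity (Sum.elim vS vT - μ - Ltil *ᵥ x) Mdag := by
  have hsub {a b : ℝ} (h0 : 0 ≤ a) (hab : a ≤ b) (hb : b ≤ T) :
      Set.uIcc a b ⊆ Set.Icc 0 T := by
    rw [Set.uIcc_of_le hab]; exact Set.Icc_subset_Icc h0 hb
  have hS : S ∈ Set.Icc (0 : ℝ) T := ⟨ht.trans htS.le, hST.le⟩
  have htr (u s : ℝ) : transMat Φ u s = transMat Φ u S * transMat Φ S s :=
    (transMat_mul_transMat Φ u S s (hΦinv S hS)).symm
  have hΦc : ContinuousOn Φ (Set.Icc 0 T) :=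
    continuousOn_matrix_iff.mpr fun i j r hr => (hΦ r hr i j).continuousAt.continuousWithinAt
  have htm (u : ℝ) : ContinuousOn (fun τ => transMat Φ u τ) (Set.Icc 0 T) :=
    continuousOn_matrix_mul continuousOn_const (continuousOn_matrix_inv hΦc hΦinv)
  have hcov (u u' : ℝ) : ContinuousOn
      (fun τ => transMat Φ u τ * atil τ * (transMat Φ u' τ)ᵀ) (Set.Icc 0 T) :=
    continuousOn_matrix_mul (continuousOn_matrix_mul (htm u) ha)
      (continuousOn_matrix_transpose (htm u'))
  have hmean (u : ℝ) : ContinuousOn (fun τ => transMat Φ u τ *ᵥ βtil τ) (Set.Icc 0 T) :=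
    continuousOn_mulVec (htm u) hβ
  have hcovI (u u' : ℝ) {a b : ℝ} (h0 : 0 ≤ a) (hab : a ≤ b) (hb : b ≤ T) (i j : Fin d) :
      IntervalIntegrable (fun τ => (transMat Φ u τ * atil τ * (transMat Φ u' τ)ᵀ) i j)
        volume a b :=
    ((continuousOn_matrix_iff.mp (hcov u u') i j).mono
      (hsub h0 hab hb)).intervalIntegrable
  have hmeanI (u : ℝ) {a b : ℝ} (h0 : 0 ≤ a) (hab : a ≤ b) (hb : b ≤ T) (i : Fin d) :
      IntervalIntegrable (fun τ => (transMat Φ u τ *ᵥ βtil τ) i) volume a b :=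
    ((continuousOn_pi.mp (hmean u) i).mono (hsub h0 hab hb)).intervalIntegrable
  have hS0 : 0 ≤ S := hS.1
  set Γ₁ := transCov Φ atil t S
  set Γ₂ := transCov Φ atil S T
  set K := LT * transMat Φ T S with hK
  set C := SigT + LT * Γ₂ * LTᵀ with hC
  set b₁ : Fin d → ℝ := fun i => ∫ τ in t..S, (transMat Φ S τ *ᵥ βtil τ) i with hb₁
  set b₂ : Fin d → ℝ := fun i => ∫ τ in S..T, (transMat Φ T τ *ᵥ βtil τ) i with hb₂
  have hCpos : C.PosDef := GaussianConvolution.posDef_add_mul_mul_transpose hΓST hSigT LT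
  
  have hcovS {m n : ℕ} (X : Matrix (Fin m) (Fin d) ℝ) (Y : Matrix (Fin d) (Fin n) ℝ) :
      X * Γ₁ * Y = Matrix.of fun i j =>
        ∫ τ in t..S, (X * (transMat Φ S τ * atil τ * (transMat Φ S τ)ᵀ) * Y) i j :=
    mul_of_intervalIntegral_mul (hcovI S S ht htS.le hST.le) X Y
  have hcovT : LT * Γ₂ * LTᵀ = Matrix.of fun i j =>
        ∫ τ in S..T, (LT * (transMat Φ T τ * atil τ * (transMat Φ T τ)ᵀ) * LTᵀ) i j :=
    mul_of_intervalIntegral_mul (hcovI T T hS0 hST.le le_rfl) LT LTᵀ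
  have hM : Mdag = fromBlocks SigS 0 0 C + fromRows LS K * Γ₁ * (fromRows LS K)ᵀ := by
    rw [hMdag, transpose_fromRows, fromRows_mul, fromRows_mul_fromCols, fromBlocks_add]
    have h12 : (Matrix.of fun i j => ∫ τ in t..S,
        (LS * transMat Φ S τ * atil τ * (transMat Φ T τ)ᵀ * LTᵀ) i j) = LS * Γ₁ * Kᵀ := by
      have h (τ : ℝ) : LS * transMat Φ S τ * atil τ * (transMat Φ T τ)ᵀ * LTᵀ =
          LS * (transMat Φ S τ * atil τ * (transMat Φ S τ)ᵀ) * Kᵀ := by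
        rw [htr T τ, hK]
        simp only [transpose_mul, Matrix.mul_assoc]
      rw [hcovS]
      simp_rw [h]
    have hΓ₁t : Γ₁ᵀ = Γ₁ := by
      simpa [conjTranspose_eq_transpose_of_trivial] using hΓtS.isHermitian.eq
    congr 1
    · rw [hcovS, add_comm]
      simp only [Matrix.mul_assoc]
    · rw [h12, zero_add]
    · rw [h12, zero_add]
      simp only [transpose_mul, transpose_transpose, hΓ₁t, Matrix.mul_assoc]
    · rw [hC, add_assoc, add_comm]
      congr 1
      rw [hcovT, hcovS]
      ext i j
      have hI {a b : ℝ} (h0 : 0 ≤ a) (hab : a ≤ b) (hb : b ≤ T) : IntervalIntegrable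
          (fun τ => (LT * transMat Φ T τ * atil τ * (transMat Φ T τ)ᵀ * LTᵀ) i j)
          volume a b := by
        refine ((continuousOn_matrix_iff.mp ?_ i j).mono (hsub h0 hab hb)).intervalIntegrable
        simp only [Matrix.mul_assoc]
        simpa only [Matrix.mul_assoc] using continuousOn_matrix_mul
          (continuousOn_matrix_mul continuousOn_const (hcov T T)) continuousOn_const
      rw [Matrix.add_apply, of_apply, of_apply, of_apply,
        ← intervalIntegral.integral_add_adjacent_intervals (hI ht htS.le hST.le)
          (hI hS0 hST.le le_rfl), add_comm]
      congr 1
      · simp only [Matrix.mul_assoc]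
      · have h (τ : ℝ) : LT * transMat Φ T τ * atil τ * (transMat Φ T τ)ᵀ * LTᵀ =
            K * (transMat Φ S τ * atil τ * (transMat Φ S τ)ᵀ) * Kᵀ := by
          rw [htr T τ, hK]
          simp only [transpose_mul, Matrix.mul_assoc]
        simp_rw [h]
  have hblock := GaussianConvolution.posDef_fromBlocks_zero hSigS hCpos
  have hMpos : Mdag.PosDef := by
    rw [hM]
    exact GaussianConvolution.posDef_add_mul_mul_transpose hΓtS hblock _
  refine ⟨hMpos, fun x => ?_⟩
  have hinner (ξ : Fin d → ℝ) :
      (∫ η, transDensity Φ atil βtil t x S ξ * transDensity Φ atil βtil S ξ T η *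
        gaussianDensity (vS - LS *ᵥ ξ) SigS * gaussianDensity (vT - LT *ᵥ η) SigT) =
      gaussianDensity (ξ - (transMat Φ S t *ᵥ x + b₁)) Γ₁ *
        gaussianDensity (Sum.elim vS (vT - LT *ᵥ b₂) - fromRows LS K *ᵥ ξ)
          (fromBlocks SigS 0 0 C) := by
    have h1 (η : Fin d → ℝ) :
        transDensity Φ atil βtil t x S ξ * transDensity Φ atil βtil S ξ T η *
          gaussianDensity (vS - LS *ᵥ ξ) SigS * gaussianDensity (vT - LT *ᵥ η) SigT =
        (gaussianDensity (ξ - (transMat Φ S t *ᵥ x + b₁)) Γ₁ *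
          gaussianDensity (vS - LS *ᵥ ξ) SigS) *
        (gaussianDensity (η - (transMat Φ T S *ᵥ ξ + b₂)) Γ₂ *
          gaussianDensity (vT - LT *ᵥ η) SigT) := by
      rw [transDensity, transDensity, sub_sub, sub_sub]
      ring
    have h2 : Sum.elim vS (vT - LT *ᵥ b₂) - fromRows LS K *ᵥ ξ =
        Sum.elim (vS - LS *ᵥ ξ) (vT - LT *ᵥ (transMat Φ T S *ᵥ ξ + b₂)) := by
      rw [fromRows_mulVec, ← Sum.elim_sub_sub, mulVec_add, mulVec_mulVec]
      congr 1
      abel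
    simp_rw [h1]
    rw [MeasureTheory.integral_const_mul,
      GaussianConvolution.integral_gaussianDensity_mul_gaussianDensity hΓST hSigT, h2,
      GaussianConvolution.gaussianDensity_sumElim hSigS hCpos, mul_assoc]
  simp_rw [hinner]
  rw [GaussianConvolution.integral_gaussianDensity_mul_gaussianDensity hΓtS hblock, ← hM]
  congr 1
  have hμS : (fun i => ∫ τ in t..S, ((LS * transMat Φ S τ) *ᵥ βtil τ) i) = LS *ᵥ b₁ := by
    rw [hb₁, mulVec_intervalIntegral (hmeanI S ht htS.le hST.le)]
    simp only [mulVec_mulVec]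
  have hμT : (fun i => ∫ τ in t..T, ((LT * transMat Φ T τ) *ᵥ βtil τ) i) =
      K *ᵥ b₁ + LT *ᵥ b₂ := by
    have hsum : (fun i => ∫ τ in t..T, (transMat Φ T τ *ᵥ βtil τ) i) =
        transMat Φ T S *ᵥ b₁ + b₂ := by
      rw [hb₁, mulVec_intervalIntegral (hmeanI S ht htS.le hST.le)]
      ext i
      rw [Pi.add_apply, ← intervalIntegral.integral_add_adjacent_intervals
        (hmeanI T ht htS.le hST.le i) (hmeanI T hS0 hST.le le_rfl i)]
      simp only [mulVec_mulVec, ← htr, hb₂]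
    rw [hK, ← mulVec_mulVec, ← mulVec_add, ← hsum,
      mulVec_intervalIntegral (hmeanI T ht (htS.trans hST).le le_rfl)]
    simp only [mulVec_mulVec]
  rw [hμ, hLtil, hμS, hμT, htr T t, fromRows_mulVec, fromRows_mulVec, ← Sum.elim_sub_sub,
    ← Sum.elim_sub_sub, ← Sum.elim_sub_sub, mulVec_add, mulVec_add, mulVec_mulVec,
    mulVec_mulVec, ← Matrix.mul_assoc]
  congr 1 <;> abel
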